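/- Let m, n be positive integers with n ≥ 2 and n ≠ m + 2. Let ‖·‖₁ and ‖·‖₂ be any norms on ℝⁿ and ℝᵐ respectively, and let ‖·‖₁′ be the restriction of ‖·‖₁ to ℝ² given by ‖(x₁,x₂)‖₁′ = ‖(x₁,x₂,0,…,0)‖₁. Let V ∈ ℝ^{m×2} satisfy limsup_{t→∞} t^{n/m} ψ_V(‖·‖₁′, ‖·‖₂, t) = c for sufficiently small c > 0 (depending on m, n and the norms). Let (b_v)_{v≥1} ⊂ ℤ^{m+2} be the associated sequence of best approximations with b̂_v = (b_{1,v}, b_{2,v}), heights M_v = ‖b̂_v‖₁′ and values L_v = ‖V·b̂_v + b̃_v‖₂. Then there is a set 𝒴 of positive m(n−2)-dimensional Lebesgue measure in the unit ball B_{m(n−2)}(0,1) ⊆ ℝ^{m(n−2)}, consisting of matrices B ∈ ℝ^{m×(n−2)}, such that for infinitely many integers v ≥ 1, setting T_v = M_{v+1} − 1/2, the best approximation for Ω = (V, B) ∈ ℝ^{m×n} at T_v is (b_{1,v}, b_{2,v}, 0, …, 0, b_{3,v}, …, b_{m+2,v}) ∈ ℤ^{n+m}, and hence ψ_Ω(‖·‖₁,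 ‖·‖₂, T_v) = ψ_V(‖·‖₁′, ‖·‖₂, T_v) = L_v. -/

import Mathlib

open Filter MeasureTheory

/-- `N` is a norm on `ℝ^k` (viewed as `Fin k → ℝ`). -/
def IsNorm {k : ℕ} (N : (Fin k → ℝ) → ℝ) : Prop :=
  (∀ x, N x = 0 ↔ x = 0) ∧ (∀ (c : ℝ) (x : Fin k → ℝ), N (c • x) = |c| * N x) ∧
    ∀ x y, N (x + y) ≤ N x + N y

/-- The best approximation function `ψ_Ω(‖·‖₁,‖·‖₂,t)` of an `m × n` matrix `Ω`,
formulated for an arbitrary number `n` of columns. -/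
noncomputable def psiGen (m n : ℕ) (N1 : (Fin n → ℝ) → ℝ) (N2 : (Fin m → ℝ) → ℝ)
    (Ω : Fin m → Fin n → ℝ) (t : ℝ) : ℝ :=
  sInf { r : ℝ | ∃ (bh : Fin n → ℤ) (bt : Fin m → ℤ),
    1 ≤ N1 (fun i => (bh i : ℝ)) ∧ N1 (fun i => (bh i : ℝ)) ≤ t ∧
    r = N2 (fun j => (∑ i, Ω j i * (bh i : ℝ)) + (bt j : ℝ)) }

/-- The embedding `ℝ² → ℝⁿ` into the first two coordinates (used to restrict a norm
on `ℝⁿ` to `ℝ²`). -/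
def embedTwo (n : ℕ) (x : Fin 2 → ℝ) : Fin n → ℝ :=
  fun i => if (i : ℕ) = 0 then x 0 else if (i : ℕ) = 1 then x 1 else 0

/-- The matrix `Ω = (V, B) ∈ ℝ^{m×n}` obtained by placing `B ∈ ℝ^{m×(n−2)}` to the
right of `V ∈ ℝ^{m×2}`. -/
def glueMat (m n : ℕ) (V : Fin m → Fin 2 → ℝ) (B : Fin m → Fin (n - 2) → ℝ) :
    Fin m → Fin n → ℝ :=
  fun j i =>
    if h0 : (i : ℕ) = 0 then V j 0
    else if h1 : (i : ℕ) = 1 then V j 1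
    else B j ⟨(i : ℕ) - 2, by have := i.isLt; omega⟩

namespace IsNorm

variable {k : ℕ} {N : (Fin k → ℝ) → ℝ}

lemma map_neg (h : IsNorm N) (x : Fin k → ℝ) : N (-x) = N x := by
  have := h.2.1 (-1) x
  simpa using this

lemma nonneg (h : IsNorm N) (x : Fin k → ℝ) : 0 ≤ N x := by
  have h1 := h.2.2 x (-x)
  rw [add_neg_cancel, (h.1 0).2 rfl, h.map_neg] at h1
  linarith

lemma map_sum_le (h : IsNorm N) {ι : Type*} (s : Finset ι) (f : ι → Fin k → ℝ) :
    N (∑ i ∈ s, f i) ≤ ∑ i ∈ s, N (f i) := by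
  classical
  induction s using Finset.induction_on with
  | empty => simp [(h.1 0).2 rfl]
  | insert a s ha ih =>
    rw [Finset.sum_insert ha, Finset.sum_insert ha]
    exact (h.2.2 _ _).trans (by gcongr)

lemma exists_le_mul_norm (h : IsNorm N) : ∃ C : ℝ, 0 < C ∧ ∀ x, N x ≤ C * ‖x‖ := by
  refine ⟨1 + ∑ i, N (Pi.single i 1),
    add_pos_of_pos_of_nonneg one_pos (Finset.sum_nonneg fun i _ => h.nonneg _), fun x => ?_⟩
  have hx : x = ∑ i, x i • (Pi.single i (1 : ℝ) : Fin k → ℝ) := pi_eq_sum_univ' x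
  calc N x = N (∑ i, x i • (Pi.single i (1 : ℝ) : Fin k → ℝ)) := by rw [← hx]
    _ ≤ ∑ i, N (x i • (Pi.single i (1 : ℝ) : Fin k → ℝ)) := h.map_sum_le _ _
    _ ≤ ∑ i, N (Pi.single i 1) * ‖x‖ := by
        refine Finset.sum_le_sum fun i _ => ?_
        rw [h.2.1, mul_comm]
        exact mul_le_mul_of_nonneg_left (norm_le_pi_norm x i) (h.nonneg _)
    _ ≤ (1 + ∑ i, N (Pi.single i 1)) * ‖x‖ := by
        rw [← Finset.sum_mul]
        gcongr
        linarith

lemma continuous (h : IsNorm N) : Continuous N := by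
  obtain ⟨C, hC, hle⟩ := h.exists_le_mul_norm
  refine (LipschitzWith.of_dist_le_mul (K := C.toNNReal) fun x y => ?_).continuous
  rw [Real.coe_toNNReal _ hC.le, Real.dist_eq, dist_eq_norm, abs_sub_le_iff]
  have h1 := h.2.2 (x - y) y
  have h2 := h.2.2 (y - x) x
  have h3 := hle (x - y)
  have h4 := h.map_neg (x - y)
  rw [neg_sub] at h4
  rw [sub_add_cancel] at h1 h2
  constructor <;> linarith

lemma exists_mul_norm_le (h : IsNorm N) : ∃ κ : ℝ, 0 < κ ∧ ∀ x, κ * ‖x‖ ≤ N x := by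
  rcases (Metric.sphere (0 : Fin k → ℝ) 1).eq_empty_or_nonempty with he | hne
  · refine ⟨1, one_pos, fun x => ?_⟩
    have hx : x = 0 := by
      by_contra hx
      have : (‖x‖⁻¹ • x) ∈ Metric.sphere (0 : Fin k → ℝ) 1 := by
        simp [norm_smul, hx]
      simp [he] at this
    simp [hx, (h.1 0).2 rfl]
  · obtain ⟨y, hy, hmin⟩ := (isCompact_sphere (0 : Fin k → ℝ) 1).exists_isMinOn hne
      h.continuous.continuousOn
    have hy0 : y ≠ 0 := by
      rintro rfl
      simp at hy
    refine ⟨N y, lt_of_le_of_ne (h.nonneg y) fun he => hy0 ((h.1 y).1 he.symm), fun x => ?_⟩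
    rcases eq_or_ne x 0 with rfl | hx
    · simp [(h.1 0).2 rfl]
    · have hmem : (‖x‖⁻¹ • x) ∈ Metric.sphere (0 : Fin k → ℝ) 1 := by
        simp [norm_smul, hx]
      have hle : N y ≤ N (‖x‖⁻¹ • x) := hmin hmem
      rw [h.2.1, abs_of_nonneg (by positivity)] at hle
      have hpos : 0 < ‖x‖ := norm_pos_iff.2 hx
      rwa [inv_mul_eq_div, le_div_iff₀ hpos] at hle

end IsNorm

lemma IsNorm.comp_embedTwo {n : ℕ} (hn : 2 ≤ n) {N : (Fin n → ℝ) → ℝ} (h : IsNorm N) :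
    IsNorm (fun x => N (embedTwo n x)) := by
  refine ⟨fun x => ?_, fun c x => ?_, fun x y => ?_⟩
  · rw [h.1]
    constructor
    · intro hx
      have h0 := congrFun hx ⟨0, by omega⟩
      have h1 := congrFun hx ⟨1, by omega⟩
      simp only [embedTwo] at h0 h1
      ext i
      fin_cases i
      · simpa using h0
      · simpa using h1
    · rintro rfl
      ext i
      simp [embedTwo]
  · rw [← h.2.1]
    refine congrArg N (funext fun i => ?_)
    simp [embedTwo]
  · refine le_of_eq_of_le (congrArg N (funext fun i => ?_)) (h.2.2 _ _)
    simp only [embedTwo, Pi.add_apply]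
    split_ifs <;> simp

section psiGen

variable {m n : ℕ} {N1 : (Fin n → ℝ) → ℝ} {N2 : (Fin m → ℝ) → ℝ} {Ω : Fin m → Fin n → ℝ} {t : ℝ}

lemma psiGen_le (h2 : IsNorm N2) (bh : Fin n → ℤ) (bt : Fin m → ℤ)
    (h1 : 1 ≤ N1 (fun i => (bh i : ℝ))) (ht : N1 (fun i => (bh i : ℝ)) ≤ t) :
    psiGen m n N1 N2 Ω t ≤ N2 (fun j => (∑ i, Ω j i * (bh i : ℝ)) + (bt j : ℝ)) := by
  refine csInf_le ⟨0, ?_⟩ ⟨bh, bt, h1, ht, rfl⟩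
  rintro r ⟨_, _, _, _, rfl⟩
  exact h2.nonneg _

lemma le_psiGen {l : ℝ} (hne : ∃ bh : Fin n → ℤ, 1 ≤ N1 (fun i => (bh i : ℝ)) ∧
      N1 (fun i => (bh i : ℝ)) ≤ t)
    (h : ∀ (bh : Fin n → ℤ) (bt : Fin m → ℤ), 1 ≤ N1 (fun i => (bh i : ℝ)) →
      N1 (fun i => (bh i : ℝ)) ≤ t →
      l ≤ N2 (fun j => (∑ i, Ω j i * (bh i : ℝ)) + (bt j : ℝ))) :
    l ≤ psiGen m n N1 N2 Ω t := by
  obtain ⟨bh, h1, ht⟩ := hne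
  refine le_csInf ⟨_, bh, 0, h1, ht, rfl⟩ ?_
  rintro r ⟨bh, bt, h1, ht, rfl⟩
  exact h bh bt h1 ht

end psiGen

/-- The last `n - 2` coordinates of an integer vector. -/
def intTail {n : ℕ} (b : Fin n → ℤ) : Fin (n - 2) → ℤ :=
  fun i => b ⟨i + 2, by omega⟩

lemma glueMat_sum {m n : ℕ} (hn : 2 ≤ n) (V : Fin m → Fin 2 → ℝ) (B : Fin m → Fin (n - 2) → ℝ)
    (b : Fin n → ℤ) (j : Fin m) :
    ∑ i, glueMat m n V B j i * (b i : ℝ) =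
      (V j 0 * (b ⟨0, by omega⟩ : ℝ) + V j 1 * (b ⟨1, by omega⟩ : ℝ)) +
        ∑ i, B j i * (intTail b i : ℝ) := by
  obtain ⟨k, rfl⟩ := Nat.exists_eq_add_of_le' hn
  rw [Fin.sum_univ_succ, Fin.sum_univ_succ, ← add_assoc]
  rfl

lemma embedTwo_cast_eq {n : ℕ} (hn : 2 ≤ n) (b : Fin n → ℤ) (hb : intTail b = 0) :
    embedTwo n (fun i => ((![b ⟨0, by omega⟩, b ⟨1, by omega⟩] i : ℤ) : ℝ)) =
      fun i => (b i : ℝ) := by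
  ext ⟨i, hi⟩
  match i, hi with
  | 0, _ => simp [embedTwo]
  | 1, _ => simp [embedTwo]
  | i + 2, hi =>
    have := congrFun hb ⟨i, by omega⟩
    simp only [intTail, Pi.zero_apply] at this
    simp [embedTwo, this]

/-- The integer vector `(b₀, b₁, 0, …, 0)`. -/
def intEmbedTwo (n : ℕ) (b : Fin 2 → ℤ) : Fin n → ℤ :=
  fun i => if (i : ℕ) = 0 then b 0 else if (i : ℕ) = 1 then b 1 else 0

lemma intEmbedTwo_cast (n : ℕ) (b : Fin 2 → ℤ) :
    (fun i => (intEmbedTwo n b i : ℝ)) = embedTwo n (fun i => (b i : ℝ)) := by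
  ext i
  simp only [intEmbedTwo, embedTwo]
  split_ifs <;> simp

lemma intTail_intEmbedTwo (n : ℕ) (b : Fin 2 → ℤ) : intTail (intEmbedTwo n b) = 0 := by
  ext i
  simp [intTail, intEmbedTwo]

lemma mem_box_of_norm_le {k : ℕ} {b : Fin k → ℤ} {R : ℝ} (h : ‖fun i => (b i : ℝ)‖ ≤ R) :
    b ∈ Fintype.piFinset (fun _ : Fin k => Finset.Icc (-⌊R⌋) ⌊R⌋) := by
  rw [Fintype.mem_piFinset]
  intro i
  have hi := (norm_le_pi_norm (fun i => (b i : ℝ)) i).trans h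
  rw [Real.norm_eq_abs, abs_le] at hi
  rw [Finset.mem_Icc]
  have h1 : b i ≤ ⌊R⌋ := Int.le_floor.2 hi.2
  have h2 : -b i ≤ ⌊R⌋ := Int.le_floor.2 (by push_cast; linarith)
  omega

lemma card_box_le {k : ℕ} {R : ℝ} (hR : 0 ≤ R) :
    ((Fintype.piFinset (fun _ : Fin k => Finset.Icc (-⌊R⌋) ⌊R⌋)).card : ℝ) ≤ (2 * R + 1) ^ k := by
  rw [Fintype.card_piFinset_const, Int.card_Icc]
  push_cast
  gcongr
  have h0 : 0 ≤ ⌊R⌋ := Int.floor_nonneg.2 hR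
  have h1 : ((⌊R⌋ + 1 - -⌊R⌋).toNat : ℤ) = 2 * ⌊R⌋ + 1 := by omega
  have h2 : (((⌊R⌋ + 1 - -⌊R⌋).toNat : ℤ) : ℝ) = 2 * (⌊R⌋ : ℝ) + 1 := by
    rw [h1]; push_cast; ring
  rw [Int.cast_natCast] at h2
  rw [h2]
  linarith [Int.floor_le R]

lemma one_le_norm_intCast {k : ℕ} {b : Fin k → ℤ} (hb : b ≠ 0) : 1 ≤ ‖fun i => (b i : ℝ)‖ := by
  obtain ⟨i, hi⟩ := Function.ne_iff.1 hb
  refine le_trans ?_ (norm_le_pi_norm (fun i => (b i : ℝ)) i)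
  rw [Real.norm_eq_abs]
  exact_mod_cast Int.one_le_abs hi

lemma volume_slab_le {k : ℕ} (q : Fin k → ℝ) (i₀ : Fin k) (hq : q i₀ ≠ 0) (a ρ : ℝ) :
    volume {y : Fin k → ℝ | (∀ i, y i ∈ Set.Icc (0 : ℝ) 1) ∧ |a + ∑ i, y i * q i| < ρ} ≤
      ENNReal.ofReal (2 * ρ / |q i₀|) := by
  set A : Matrix (Fin k) (Fin k) ℝ := (1 : Matrix (Fin k) (Fin k) ℝ).updateRow i₀ q with hA
  have hdet : A.det = q i₀ := by
    rw [hA, ← Matrix.cramer_transpose_apply]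
    simp
  have hdet' : LinearMap.det (Matrix.toLin' A) = q i₀ := by rw [LinearMap.det_toLin', hdet]
  let I : Fin k → Set ℝ := fun i => if i = i₀ then Set.Ioo (-a - ρ) (-a + ρ) else Set.Icc 0 1
  have hsub : {y : Fin k → ℝ | (∀ i, y i ∈ Set.Icc (0 : ℝ) 1) ∧ |a + ∑ i, y i * q i| < ρ} ⊆
      Matrix.toLin' A ⁻¹' (Set.univ.pi I) := by
    rintro y ⟨hy, hy'⟩ i -
    by_cases hi : i = i₀
    · subst hi
      have : (Matrix.toLin' A y) i = ∑ i, y i * q i := by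
        simp [hA, Matrix.toLin'_apply, Matrix.mulVec, dotProduct, mul_comm]
      rw [this]
      rw [abs_lt] at hy'
      simp only [I, if_true, Set.mem_Ioo]
      constructor <;> linarith
    · have : (Matrix.toLin' A y) i = y i := by
        simp [hA, Matrix.toLin'_apply, Matrix.mulVec, dotProduct, hi, Matrix.one_apply]
      rw [this]
      simpa [I, hi] using hy i
  refine (measure_mono hsub).trans ?_
  rw [Measure.addHaar_preimage_linearMap _ (by rw [hdet']; exact hq), hdet', volume_pi_pi,
    Finset.prod_eq_single i₀ (by intro i _ hi; simp [I, hi]) (by simp)]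
  simp only [I, if_true, Real.volume_Ioo]
  rw [← ENNReal.ofReal_mul (abs_nonneg _)]
  apply le_of_eq
  congr 1
  rw [abs_inv]
  ring

lemma volume_slabs_le {k : ℕ} (q : Fin k → ℤ) (hq : q ≠ 0) (a : ℝ) {ρ : ℝ} (h0 : 0 ≤ ρ)
    (h1 : ρ ≤ 1) :
    volume {y : Fin k → ℝ | (∀ i, y i ∈ Set.Icc (0 : ℝ) 1) ∧
        ∃ b : ℤ, |a + ∑ i, y i * (q i : ℝ) + b| < ρ} ≤
      ENNReal.ofReal (2 * (2 * k + 3) * ρ) := by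
  obtain ⟨i₁, hi₁⟩ := Function.ne_iff.1 hq
  obtain ⟨i₀, -, hmax⟩ := Finset.exists_max_image Finset.univ (fun i => |q i|) ⟨i₁, Finset.mem_univ _⟩
  have hpos : 1 ≤ |q i₀| := (Int.one_le_abs hi₁).trans (hmax i₁ (Finset.mem_univ _))
  set Q : ℝ := |(q i₀ : ℝ)| with hQ
  have hQ1 : 1 ≤ Q := by rw [hQ]; exact_mod_cast hpos
  have hle : ∀ i, |(q i : ℝ)| ≤ Q := fun i => by
    rw [hQ]; exact_mod_cast hmax i (Finset.mem_univ _)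
  set F : Finset ℤ := Finset.Icc ⌈-a - k * Q - 1⌉ ⌊-a + k * Q + 1⌋ with hF
  have hcard : (F.card : ℝ) ≤ (2 * k + 3) * Q := by
    rw [hF, Int.card_Icc]
    have hk : (0 : ℝ) ≤ k * Q := by positivity
    have e1 := Int.floor_le (-a + k * Q + 1)
    have e2 := Int.le_ceil (-a - k * Q - 1)
    rcases le_total 0 (⌊-a + k * Q + 1⌋ + 1 - ⌈-a - k * Q - 1⌉) with h | h
    · have : (((⌊-a + k * Q + 1⌋ + 1 - ⌈-a - k * Q - 1⌉).toNat : ℤ) : ℝ) =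
          ⌊-a + k * Q + 1⌋ + 1 - ⌈-a - k * Q - 1⌉ := by
        rw [Int.toNat_of_nonneg h]; push_cast; ring
      rw [Int.cast_natCast] at this
      rw [this]
      nlinarith
    · rw [Int.toNat_of_nonpos h]
      simp only [Nat.cast_zero]
      positivity
  have hsub : {y : Fin k → ℝ | (∀ i, y i ∈ Set.Icc (0 : ℝ) 1) ∧
        ∃ b : ℤ, |a + ∑ i, y i * (q i : ℝ) + b| < ρ} ⊆
      ⋃ b ∈ F, {y : Fin k → ℝ | (∀ i, y i ∈ Set.Icc (0 : ℝ) 1) ∧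
        |(a + b) + ∑ i, y i * (q i : ℝ)| < ρ} := by
    rintro y ⟨hy, b, hb⟩
    have hs : |∑ i, y i * (q i : ℝ)| ≤ k * Q := by
      calc |∑ i, y i * (q i : ℝ)| ≤ ∑ i, |y i * (q i : ℝ)| := Finset.abs_sum_le_sum_abs _ _
        _ ≤ ∑ _i : Fin k, Q := by
          refine Finset.sum_le_sum fun i _ => ?_
          rw [abs_mul, abs_of_nonneg (hy i).1]
          calc y i * |(q i : ℝ)| ≤ 1 * Q := by
                gcongr
                exacts [(hy i).2, hle i]
            _ = Q := one_mul Q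
        _ = k * Q := by simp
    rw [abs_le] at hs
    have hb' := abs_lt.1 hb
    simp only [Set.mem_iUnion, exists_prop]
    refine ⟨b, ?_, hy, ?_⟩
    · rw [hF, Finset.mem_Icc, Int.ceil_le, Int.le_floor]
      constructor <;> linarith
    · rwa [add_right_comm] at hb
  refine (measure_mono hsub).trans ((measure_biUnion_finset_le _ _).trans ?_)
  refine (Finset.sum_le_card_nsmul F _ (ENNReal.ofReal (2 * ρ / Q)) fun b _ =>
    volume_slab_le (fun i => (q i : ℝ)) i₀ ?_ (a + (b : ℤ)) ρ).trans ?_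
  · intro h
    rw [hQ, h, abs_zero] at hQ1
    linarith
  · rw [nsmul_eq_mul, ← ENNReal.ofReal_natCast, ← ENNReal.ofReal_mul (Nat.cast_nonneg _)]
    apply ENNReal.ofReal_le_ofReal
    calc (F.card : ℝ) * (2 * ρ / Q) ≤ ((2 * k + 3) * Q) * (2 * ρ / Q) := by gcongr
      _ = 2 * (2 * k + 3) * ρ := by
        field_simp

lemma volume_bad_le {m n : ℕ} (hn : 2 ≤ n) {N1 : (Fin n → ℝ) → ℝ} {N2 : (Fin m → ℝ) → ℝ}
    {κ₁ κ₂ : ℝ} (hκ₁ : 0 < κ₁) (hκ₂ : 0 < κ₂) (h1 : ∀ x, κ₁ * ‖x‖ ≤ N1 x)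
    (h2 : ∀ x, κ₂ * ‖x‖ ≤ N2 x) (V : Fin m → Fin 2 → ℝ) {T L : ℝ} (hT : 1 ≤ T) (hL : 0 ≤ L)
    (hLκ : L ≤ κ₂) :
    volume {B : Fin m → Fin (n - 2) → ℝ | (∀ j i, B j i ∈ Set.Icc (0 : ℝ) 1) ∧
        ∃ (bh : Fin n → ℤ) (bt : Fin m → ℤ), intTail bh ≠ 0 ∧ N1 (fun i => (bh i : ℝ)) ≤ T ∧
          N2 (fun j => (∑ i, glueMat m n V B j i * (bh i : ℝ)) + (bt j : ℝ)) < L} ≤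
      ENNReal.ofReal (((2 / κ₁ + 1) * T) ^ n *
        (2 * (2 * ((n - 2 : ℕ) : ℝ) + 3) * (L / κ₂)) ^ m) := by
  classical
  set F : Finset (Fin n → ℤ) :=
    (Fintype.piFinset (fun _ : Fin n => Finset.Icc (-⌊T / κ₁⌋) ⌊T / κ₁⌋)).filter
      (fun b => intTail b ≠ 0) with hF
  let S : (Fin n → ℤ) → Fin m → Set (Fin (n - 2) → ℝ) := fun b j =>
    {y | (∀ i, y i ∈ Set.Icc (0 : ℝ) 1) ∧
      ∃ c : ℤ, |(V j 0 * (b ⟨0, by omega⟩ : ℝ) + V j 1 * (b ⟨1, by omega⟩ : ℝ)) +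
        ∑ i, y i * (intTail b i : ℝ) + c| < L / κ₂}
  have hsub : {B : Fin m → Fin (n - 2) → ℝ | (∀ j i, B j i ∈ Set.Icc (0 : ℝ) 1) ∧
        ∃ (bh : Fin n → ℤ) (bt : Fin m → ℤ), intTail bh ≠ 0 ∧ N1 (fun i => (bh i : ℝ)) ≤ T ∧
          N2 (fun j => (∑ i, glueMat m n V B j i * (bh i : ℝ)) + (bt j : ℝ)) < L} ⊆
      ⋃ b ∈ F, Set.univ.pi (S b) := by
    rintro B ⟨hB, bh, bt, htail, hbT, hbL⟩
    simp only [Set.mem_iUnion, exists_prop]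
    refine ⟨bh, ?_, fun j _ => ⟨hB j, bt j, ?_⟩⟩
    · rw [hF, Finset.mem_filter]
      refine ⟨mem_box_of_norm_le ?_, htail⟩
      rw [le_div_iff₀' hκ₁]
      exact (h1 _).trans hbT
    · rw [lt_div_iff₀' hκ₂, ← glueMat_sum hn]
      refine lt_of_le_of_lt ((mul_le_mul_of_nonneg_left ?_ hκ₂.le).trans (h2 _)) hbL
      rw [← Real.norm_eq_abs]
      exact norm_le_pi_norm
        (fun j => (∑ i, glueMat m n V B j i * (bh i : ℝ)) + (bt j : ℝ)) j
  refine (measure_mono hsub).trans ((measure_biUnion_finset_le _ _).trans ?_)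
  have hρ0 : 0 ≤ L / κ₂ := by positivity
  have hρ1 : L / κ₂ ≤ 1 := (div_le_one hκ₂).2 hLκ
  refine (Finset.sum_le_card_nsmul _ _
    (ENNReal.ofReal ((2 * (2 * ((n - 2 : ℕ) : ℝ) + 3) * (L / κ₂)) ^ m)) fun b hb => ?_).trans ?_
  · rw [volume_pi_pi]
    refine (Finset.prod_le_pow_card _ _
      (ENNReal.ofReal (2 * (2 * ((n - 2 : ℕ) : ℝ) + 3) * (L / κ₂))) fun j _ =>
        volume_slabs_le (intTail b) (Finset.mem_filter.1 hb).2 _ hρ0 hρ1).trans ?_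
    rw [Finset.card_univ, Fintype.card_fin, ENNReal.ofReal_pow (by positivity)]
  · rw [nsmul_eq_mul, ← ENNReal.ofReal_natCast, ← ENNReal.ofReal_mul (Nat.cast_nonneg _)]
    apply ENNReal.ofReal_le_ofReal
    gcongr
    calc (F.card : ℝ)
        ≤ ((Fintype.piFinset (fun _ : Fin n => Finset.Icc (-⌊T / κ₁⌋) ⌊T / κ₁⌋)).card : ℝ) := by
          exact_mod_cast Finset.card_filter_le _ _
      _ ≤ (2 * (T / κ₁) + 1) ^ n := card_box_le (by positivity)
      _ ≤ ((2 / κ₁ + 1) * T) ^ n := by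
          gcongr
          calc 2 * (T / κ₁) + 1 ≤ 2 * (T / κ₁) + T := by gcongr
            _ = (2 / κ₁ + 1) * T := by ring

lemma exists_close_pair (E : Type*) [NormedAddCommGroup E] [ProperSpace E] (R : ℝ) {ε : ℝ}
    (hε : 0 < ε) : ∃ K : ℕ, ∀ x : ℕ → E, (∀ i ≤ K, ‖x i‖ ≤ R) →
      ∃ i j, i < j ∧ j ≤ K ∧ ‖x j - x i‖ < ε := by
  classical
  obtain ⟨t, htf, ht⟩ := Metric.totallyBounded_iff.1
    (isCompact_closedBall (0 : E) R).totallyBounded (ε / 2) (by positivity)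
  refine ⟨htf.toFinset.card, fun x hx => ?_⟩
  have hnet : ∀ i, ∃ y, i ≤ htf.toFinset.card → y ∈ t ∧ dist (x i) y < ε / 2 := by
    intro i
    by_cases hi : i ≤ htf.toFinset.card
    · have := ht (mem_closedBall_zero_iff.2 (hx i hi))
      simp only [Set.mem_iUnion, exists_prop, Metric.mem_ball] at this
      obtain ⟨y, hy⟩ := this
      exact ⟨y, fun _ => hy⟩
    · exact ⟨0, fun h => absurd h hi⟩
  choose y hy using hnet
  obtain ⟨i, hi, j, hj, hij, he⟩ := Finset.exists_ne_map_eq_of_card_lt_of_maps_to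
    (s := Finset.range (htf.toFinset.card + 1)) (t := htf.toFinset) (f := y) (by simp)
    (fun i hi => by
      have := (hy i (by simpa [Nat.lt_succ_iff] using hi)).1
      simpa using this)
  rw [Finset.mem_range, Nat.lt_succ_iff] at hi hj
  have hd : ∀ i j, i ≤ htf.toFinset.card → j ≤ htf.toFinset.card → y i = y j →
      ‖x j - x i‖ < ε := by
    intro i j hi hj he
    rw [← dist_eq_norm]
    have h1 := (hy i hi).2
    have h2 := (hy j hj).2
    rw [he] at h1
    linarith [dist_triangle_right (x j) (x i) (y j)]
  rcases lt_or_gt_of_ne hij with h | h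
  · exact ⟨i, j, h, hj, hd i j hi hj he⟩
  · exact ⟨j, i, h, hi, hd j i hj hi he.symm⟩

/-- Integer vectors of strictly increasing norm have norms tending to infinity. -/
lemma exists_height_gt {k : ℕ} {N : (Fin k → ℝ) → ℝ} (h : IsNorm N) {b : ℕ → Fin k → ℤ}
    (hM : StrictMono fun v => N (fun i => (b v i : ℝ))) (A : ℝ) :
    ∃ v₀, ∀ v ≥ v₀, A < N (fun i => (b v i : ℝ)) := by
  obtain ⟨κ, hκ, hle⟩ := h.exists_mul_norm_le
  by_contra! hcon
  have hbd : ∀ v, N (fun i => (b v i : ℝ)) ≤ A := fun v => by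
    obtain ⟨w, hw, hwA⟩ := hcon v
    exact (hM.monotone hw).trans hwA
  have hinj : Function.Injective b := fun v w hvw => hM.injective (by simp only [hvw])
  refine Set.infinite_range_of_injective hinj ((Finset.finite_toSet
    (Fintype.piFinset (fun _ : Fin k => Finset.Icc (-⌊A / κ⌋) ⌊A / κ⌋))).subset ?_)
  rintro _ ⟨v, rfl⟩
  refine mem_box_of_norm_le ?_
  rw [le_div_iff₀' hκ]
  exact (hle _).trans (hbd v)

/-- Heights of best approximations with small values have gaps of length at least `1/2`
arbitrarily far out. -/
lemma exists_gap {k m : ℕ} {N : (Fin k → ℝ) → ℝ} {N2 : (Fin m → ℝ) → ℝ} (h1 : IsNorm N)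
    (h2 : IsNorm N2) {κ₂ : ℝ} (hκ₂ : 0 < κ₂) (hle2 : ∀ x, κ₂ * ‖x‖ ≤ N2 x)
    (V : Fin m → Fin k → ℝ) (bh : ℕ → Fin k → ℤ) (bt : ℕ → Fin m → ℤ) (M L : ℕ → ℝ)
    (hMdef : ∀ v, M v = N (fun i => (bh v i : ℝ)))
    (hLdef : ∀ v, L v = N2 (fun j => (∑ i, V j i * (bh v i : ℝ)) + (bt v j : ℝ)))
    (hM : StrictMono M) (hL : StrictAnti L)
    (hpsi : ∀ v, psiGen m k N N2 V (M v) = L v) (v₁ : ℕ) (hsmall : ∀ v ≥ v₁, L v ≤ κ₂) (v₀ : ℕ) :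
    ∃ v ≥ v₀, M v ≤ M (v + 1) - 1 / 2 := by
  by_contra! hcon
  obtain ⟨κ₁, hκ₁, hle1⟩ := h1.exists_mul_norm_le
  obtain ⟨C₁, hC₁, hup1⟩ := h1.exists_le_mul_norm
  obtain ⟨C₂, hC₂, hup2⟩ := h2.exists_le_mul_norm
  obtain ⟨p, hp⟩ := exists_nat_ge (1 / κ₁ + 1)
  have hp1 : 1 ≤ (p : ℝ) := le_trans (by linarith [one_div_pos.2 hκ₁]) hp
  have hpκ : 1 ≤ p * κ₁ := by
    rw [← div_le_iff₀ hκ₁]; linarith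
  set ε : ℝ := 1 / (p * (C₁ + C₂)) with hε
  have hε0 : 0 < ε := by positivity
  have hpC₁ : p * (C₁ * ε) ≤ 1 := by
    rw [hε, ← mul_assoc, mul_one_div, div_le_one (by positivity)]
    gcongr
    linarith
  have hpC₂ : p * (C₂ * ε) ≤ 1 := by
    rw [hε, ← mul_assoc, mul_one_div, div_le_one (by positivity)]
    gcongr
    linarith
  obtain ⟨K, hK⟩ := exists_close_pair ((Fin k → ℝ) × (Fin m → ℝ)) (max (2 / κ₁) (1 / κ₂)) hε0
  have hM' : StrictMono fun v => N (fun i => (bh v i : ℝ)) := by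
    simpa only [← hMdef] using hM
  obtain ⟨v₂, hv₂⟩ := exists_height_gt h1 hM' K
  set v := max v₀ (max v₁ v₂) with hv
  have hvv₀ : v₀ ≤ v := le_max_left _ _
  have hvv₁ : v₁ ≤ v := (le_max_left _ _).trans (le_max_right _ _)
  have hvK : (K : ℝ) < M v := by
    rw [hMdef]
    exact hv₂ v ((le_max_right _ _).trans (le_max_right _ _))
  have hMv : 0 < M v := K.cast_nonneg.trans_lt hvK
  have hLpos : 0 < L v := by
    refine lt_of_le_of_lt ?_ (hL (Nat.lt_succ_self v))
    rw [hLdef]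
    exact h2.nonneg _
  have hgrow : ∀ i : ℕ, M (v + i) ≤ M v + i / 2 := by
    intro i
    induction i with
    | zero => simp
    | succ i ih =>
      have := hcon (v + i) (by omega)
      rw [← add_assoc]
      push_cast
      linarith
  let w : ℕ → Fin m → ℝ := fun v j => (∑ i, V j i * (bh v i : ℝ)) + (bt v j : ℝ)
  let x : ℕ → (Fin k → ℝ) × (Fin m → ℝ) := fun i =>
    ((M v)⁻¹ • fun l => (bh (v + i) l : ℝ), (L v)⁻¹ • w (v + i))
  obtain ⟨i, j, hij, hjK, hdist⟩ := hK x (by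
    intro i hi
    have hi' : (i : ℝ) ≤ K := by exact_mod_cast hi
    rw [Prod.norm_def]
    apply max_le_max
    · have e1 := hle1 (fun l => (bh (v + i) l : ℝ))
      rw [← hMdef] at e1
      have e2 := hgrow i
      simp only [x]
      rw [norm_smul, norm_inv, Real.norm_of_nonneg hMv.le, inv_mul_le_iff₀ hMv, ← mul_div_assoc,
        le_div_iff₀' hκ₁]
      linarith
    · have e1 := hle2 (w (v + i))
      rw [← hLdef] at e1
      have e2 : L (v + i) ≤ L v := hL.antitone (by omega)
      simp only [x]
      rw [norm_smul, norm_inv, Real.norm_of_nonneg hLpos.le, inv_mul_le_iff₀ hLpos,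
        ← mul_div_assoc, le_div_iff₀' hκ₂]
      linarith)
  have hsum : ∀ (c : ℤ) (j' : Fin m),
      (∑ l, V j' l * ((c * (bh (v + j) l - bh (v + i) l) : ℤ) : ℝ)) +
        ((c * (bt (v + j) j' - bt (v + i) j') : ℤ) : ℝ) = c * (w (v + j) j' - w (v + i) j') := by
    intro c j'
    simp only [w, mul_add, mul_sub, Finset.mul_sum, Int.cast_mul, Int.cast_sub,
      Finset.sum_sub_distrib]
    have e : ∀ u, ∑ l, V j' l * ((c : ℝ) * (bh u l : ℝ)) = ∑ l, (c : ℝ) * (V j' l * (bh u l : ℝ)) :=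
      fun u => Finset.sum_congr rfl fun l _ => by ring
    rw [e, e]
    ring
  obtain ⟨hd1, hd2⟩ := max_lt_iff.1 ((Prod.norm_def _).symm.trans_lt hdist)
  have hd1' : ‖(fun l => ((bh (v + j) l - bh (v + i) l : ℤ) : ℝ))‖ < ε * M v := by
    have : (x j - x i).1 = (M v)⁻¹ • fun l => ((bh (v + j) l - bh (v + i) l : ℤ) : ℝ) := by
      ext l
      simp [x, mul_sub]
    rw [this, norm_smul, norm_inv, Real.norm_of_nonneg hMv.le, inv_mul_lt_iff₀ hMv] at hd1
    linarith
  have hd2' : ‖w (v + j) - w (v + i)‖ < ε * L v := by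
    have : (x j - x i).2 = (L v)⁻¹ • (w (v + j) - w (v + i)) := by
      ext l
      simp [x, mul_sub]
    rw [this, norm_smul, norm_inv, Real.norm_of_nonneg hLpos.le, inv_mul_lt_iff₀ hLpos] at hd2
    linarith
  have hN2 : p * N2 (w (v + j) - w (v + i)) < L v := by
    calc p * N2 (w (v + j) - w (v + i)) ≤ p * (C₂ * ‖w (v + j) - w (v + i)‖) := by
          gcongr; exact hup2 _
      _ < p * (C₂ * (ε * L v)) := by gcongr
      _ = (p * (C₂ * ε)) * L v := by ring
      _ ≤ 1 * L v := by gcongr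
      _ = L v := one_mul _
  by_cases hz : (fun l => bh (v + j) l - bh (v + i) l) = 0
  · have hbh : bh (v + j) = bh (v + i) := by
      ext l
      have := congrFun hz l
      simp only [Pi.zero_apply] at this
      omega
    have hbt : (fun l => bt (v + j) l - bt (v + i) l) = 0 := by
      by_contra hne
      have e1 := one_le_norm_intCast hne
      have e2 : (fun l => ((bt (v + j) l - bt (v + i) l : ℤ) : ℝ)) = w (v + j) - w (v + i) := by
        ext l
        simp [w, hbh]
      rw [e2] at e1
      have e3 := hle2 (w (v + j) - w (v + i))
      have e4 := hsmall v hvv₁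
      have e5 := h2.nonneg (w (v + j) - w (v + i))
      nlinarith
    have hbt' : bt (v + j) = bt (v + i) := by
      ext l
      have := congrFun hbt l
      simp only [Pi.zero_apply] at this
      omega
    have : L (v + j) < L (v + i) := hL (by omega)
    rw [hLdef, hLdef, hbh, hbt'] at this
    exact lt_irrefl _ this
  · have e1 := one_le_norm_intCast hz
    have e2 := hle1 (fun l => ((bh (v + j) l - bh (v + i) l : ℤ) : ℝ))
    have e3 := hup1 (fun l => ((bh (v + j) l - bh (v + i) l : ℤ) : ℝ))
    have hscale : N (fun l => (((p : ℤ) * (bh (v + j) l - bh (v + i) l) : ℤ) : ℝ)) =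
        p * N (fun l => ((bh (v + j) l - bh (v + i) l : ℤ) : ℝ)) := by
      have := h1.2.1 (p : ℝ) (fun l => ((bh (v + j) l - bh (v + i) l : ℤ) : ℝ))
      rw [abs_of_nonneg (Nat.cast_nonneg p)] at this
      rw [← this]
      congr 1
      ext l
      simp
    have hpl := psiGen_le (t := M v) (Ω := V) h2
      (fun l => (p : ℤ) * (bh (v + j) l - bh (v + i) l))
      (fun l => (p : ℤ) * (bt (v + j) l - bt (v + i) l)) (N1 := N) (by
        rw [hscale]
        calc 1 ≤ p * κ₁ := hpκ
          _ ≤ p * (κ₁ * ‖fun l => ((bh (v + j) l - bh (v + i) l : ℤ) : ℝ)‖) := by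
            gcongr
            exact le_mul_of_one_le_right hκ₁.le e1
          _ ≤ _ := by gcongr) (by
        rw [hscale]
        calc p * N (fun l => ((bh (v + j) l - bh (v + i) l : ℤ) : ℝ))
            ≤ p * (C₁ * ‖fun l => ((bh (v + j) l - bh (v + i) l : ℤ) : ℝ)‖) := by gcongr
          _ ≤ p * (C₁ * (ε * M v)) := by gcongr
          _ = (p * (C₁ * ε)) * M v := by ring
          _ ≤ 1 * M v := by gcongr
          _ = M v := one_mul _)
    rw [hpsi] at hpl
    refine absurd hN2 (not_lt.2 (hpl.trans (le_of_eq ?_)))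
    have := h2.2.1 (p : ℝ) (w (v + j) - w (v + i))
    rw [abs_of_nonneg (Nat.cast_nonneg p)] at this
    rw [← this]
    congr 1
    ext j'
    rw [hsum]
    simp

lemma measure_infinitely_often_pos {α : Type*} [MeasurableSpace α] (μ : Measure α) {D : Set α}
    (hD0 : μ D ≠ 0) (hD : μ D ≠ ⊤) (W : Set ℕ) (hW : W.Infinite) (G : ℕ → Set α)
    (hG : ∀ v ∈ W, μ (D \ G v) ≤ μ D / 2) :
    0 < μ (D ∩ {x | {v | v ∈ W ∧ x ∈ G v}.Infinite}) := by
  rw [pos_iff_ne_zero]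
  intro h0
  let S : ℕ → Set α := fun k => {x | x ∈ D ∧ ∀ v ∈ W, k ≤ v → x ∉ G v}
  have hmono : Monotone S := fun a b hab x hx => ⟨hx.1, fun v hv hbv => hx.2 v hv (hab.trans hbv)⟩
  have hS : μ (⋃ k, S k) ≤ μ D / 2 := by
    rw [hmono.measure_iUnion]
    refine iSup_le fun k => ?_
    obtain ⟨v, hv, hkv⟩ := hW.exists_gt k
    have hsub : S k ⊆ D \ G v := fun x hx => ⟨hx.1, hx.2 v hv hkv.le⟩
    exact (measure_mono hsub).trans (hG v hv)
  have hcover : D ⊆ (D ∩ {x | {v | v ∈ W ∧ x ∈ G v}.Infinite}) ∪ ⋃ k, S k := by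
    intro x hx
    by_cases hinf : {v | v ∈ W ∧ x ∈ G v}.Infinite
    · exact Or.inl ⟨hx, hinf⟩
    · obtain ⟨k, hk⟩ := (Set.not_infinite.1 hinf).bddAbove
      refine Or.inr (Set.mem_iUnion.2 ⟨k + 1, hx, fun v hv hkv hxv => ?_⟩)
      have : v ≤ k := hk ⟨hv, hxv⟩
      omega
  have hle : μ D ≤ μ D / 2 := by
    refine (measure_mono hcover).trans ((measure_union_le _ _).trans ?_)
    rw [h0, zero_add]
    exact hS
  exact absurd hle (not_le.2 (ENNReal.half_lt_self hD0 hD))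

lemma eventually_le_of_limsup_eq {f : ℝ → ℝ} {c d : ℝ} (hc : 0 < c) (hd : c < d)
    (h : limsup f atTop = c) : ∀ᶠ t in atTop, f t ≤ d := by
  rw [limsup_eq] at h
  have hne : {a | ∀ᶠ t in atTop, f t ≤ a}.Nonempty := by
    by_contra he
    rw [Set.not_nonempty_iff_eq_empty.1 he, Real.sInf_empty] at h
    exact hc.ne h
  obtain ⟨a, ha, had⟩ := exists_lt_of_csInf_lt hne (h.trans_lt hd)
  exact ha.mono fun t ht => ht.trans had.le

/-- If no vector with nonzero tail beats the value `L` of a best approximation of `V`, then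
`(V, B)` has the same best approximation value. -/
lemma psiGen_glueMat_eq {m n : ℕ} (hn : 2 ≤ n) {N1 : (Fin n → ℝ) → ℝ} {N2 : (Fin m → ℝ) → ℝ}
    (h2 : IsNorm N2) (V : Fin m → Fin 2 → ℝ) (B : Fin m → Fin (n - 2) → ℝ) {T L : ℝ}
    (bh : Fin 2 → ℤ) (bt : Fin m → ℤ) (h1 : 1 ≤ N1 (embedTwo n (fun i => (bh i : ℝ))))
    (hT : N1 (embedTwo n (fun i => (bh i : ℝ))) ≤ T)
    (hL : L = N2 (fun j => (∑ i, V j i * (bh i : ℝ)) + (bt j : ℝ)))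
    (hpsi : psiGen m 2 (fun x => N1 (embedTwo n x)) N2 V T = L)
    (hgood : ∀ (b : Fin n → ℤ) (c : Fin m → ℤ), intTail b ≠ 0 → N1 (fun i => (b i : ℝ)) ≤ T →
      L ≤ N2 (fun j => (∑ i, glueMat m n V B j i * (b i : ℝ)) + (c j : ℝ))) :
    psiGen m n N1 N2 (glueMat m n V B) T = L := by
  rw [← intEmbedTwo_cast] at h1 hT
  apply le_antisymm
  · refine (psiGen_le h2 (intEmbedTwo n bh) bt h1 hT).trans (le_of_eq ?_)
    rw [hL]
    congr 1
    ext j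
    rw [glueMat_sum hn, intTail_intEmbedTwo]
    simp [intEmbedTwo]
  · refine le_psiGen ⟨intEmbedTwo n bh, h1, hT⟩ fun b c hb1 hbT => ?_
    by_cases htail : intTail b = 0
    · rw [← embedTwo_cast_eq hn b htail] at hb1 hbT
      rw [← hpsi]
      refine (psiGen_le (N1 := fun x => N1 (embedTwo n x)) h2
        ![b ⟨0, by omega⟩, b ⟨1, by omega⟩] c hb1 hbT).trans (le_of_eq ?_)
      congr 1
      ext j
      rw [glueMat_sum hn, htail]
      simp
    · exact hgood b c htail hbT

/-- for `n ≥ 2`, `n ≠ m + 2`, arbitrary norms `‖·‖₁` on `ℝⁿ`, `‖·‖₂`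
on `ℝᵐ` and `‖·‖₁′` the restriction of `‖·‖₁` to `ℝ²`: for all small enough `c > 0`
and any `V ∈ ℝ^{m×2}` with `limsup t^{n/m} ψ_V(‖·‖₁′,‖·‖₂,t) = c`, given the
sequence of best approximations of `V` with heights `M_v` and values `L_v`, there is
a set `𝒴` of positive `m(n−2)`-dimensional Lebesgue measure inside the unit ball of
`ℝ^{m(n−2)}`, consisting of matrices `B`, such that for infinitely many `v`, with
`T_v = M_{v+1} − 1/2`, `ψ_{(V,B)}(‖·‖₁,‖·‖₂,T_v) = ψ_V(‖·‖₁′,‖·‖₂,T_v) = L_v`. -/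
theorem best_approx_stability_matrix (m n : ℕ) (hm : 0 < m) (hn : 2 ≤ n)
    (hne : n ≠ m + 2)
    (N1 : (Fin n → ℝ) → ℝ) (N2 : (Fin m → ℝ) → ℝ)
    (hN1 : IsNorm N1) (hN2 : IsNorm N2) :
    ∃ c0 : ℝ, 0 < c0 ∧
      ∀ c : ℝ, 0 < c → c ≤ c0 →
      ∀ V : Fin m → Fin 2 → ℝ,
        limsup (fun t : ℝ =>
            t ^ ((n : ℝ) / (m : ℝ)) *
              psiGen m 2 (fun x => N1 (embedTwo n x)) N2 V t) atTop = c →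
        ∀ (bh : ℕ → Fin 2 → ℤ) (bt : ℕ → Fin m → ℤ) (M L : ℕ → ℝ),
          (∀ v, M v = N1 (embedTwo n (fun i => (bh v i : ℝ)))) →
          (∀ v, L v = N2 (fun j => (∑ i, V j i * (bh v i : ℝ)) + (bt v j : ℝ))) →
          (∀ v, 1 ≤ M v) → StrictMono M → StrictAnti L →
          (∀ (v : ℕ) (t : ℝ), M v ≤ t → t < M (v + 1) →
            psiGen m 2 (fun x => N1 (embedTwo n x)) N2 V t = L v) →
          ∃ 𝒴 : Set (Fin m → Fin (n - 2) → ℝ),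
            𝒴 ⊆ {B | ∑ j, ∑ i, (B j i) ^ 2 ≤ 1} ∧
            0 < volume 𝒴 ∧
            ∀ B ∈ 𝒴,
              {v : ℕ |
                psiGen m n N1 N2 (glueMat m n V B) (M (v + 1) - 1 / 2) = L v ∧
                psiGen m 2 (fun x => N1 (embedTwo n x)) N2 V (M (v + 1) - 1 / 2) =
                  L v}.Infinite := by
  obtain ⟨κ₁, hκ₁, hle1⟩ := hN1.exists_mul_norm_le
  obtain ⟨κ₂, hκ₂, hle2⟩ := hN2.exists_mul_norm_le
  set s : ℝ := 1 / (m * n) with hs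
  have hm1 : (1 : ℝ) ≤ m := by exact_mod_cast hm
  have hn2 : (2 : ℝ) ≤ n := by exact_mod_cast hn
  have hs0 : 0 < s := by positivity
  have hs1 : s ≤ 1 := by
    rw [hs, div_le_one (by positivity)]
    nlinarith
  set A : ℝ := (2 / κ₁ + 1) ^ n * (2 * (2 * ((n - 2 : ℕ) : ℝ) + 3) / κ₂) ^ m with hA
  have hA0 : 0 < A := by positivity
  set δ : ℝ := (s ^ (n - 2)) ^ m with hδ
  have hδ0 : 0 < δ := by positivity
  refine ⟨min (1 / 2) (min (κ₂ / 2) (δ / (4 * A))), by positivity, ?_⟩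
  intro c hc hc0 V hlim bh bt M L hMdef hLdef hM1 hM hL hpsi
  have hc1 : 2 * c ≤ 1 := by linarith [hc0.trans (min_le_left _ _)]
  have hc2 : 2 * c ≤ κ₂ := by
    linarith [hc0.trans ((min_le_right _ _).trans (min_le_left _ _))]
  have hc3 : A * (2 * c) ≤ δ / 2 := by
    have := hc0.trans ((min_le_right _ _).trans (min_le_right _ _))
    rw [le_div_iff₀ (by positivity)] at this
    linarith
  obtain ⟨t₀, ht₀⟩ := eventually_atTop.1
    (eventually_le_of_limsup_eq hc (show c < 2 * c by linarith) hlim)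
  have hN1' := hN1.comp_embedTwo hn
  have hM' : StrictMono fun v => N1 (embedTwo n (fun i => (bh v i : ℝ))) := by
    simpa only [← hMdef] using hM
  obtain ⟨v₁, hv₁⟩ := exists_height_gt hN1' hM' t₀
  have hLnn : ∀ v, 0 ≤ L v := fun v => by
    rw [hLdef]
    exact hN2.nonneg _
  have hbound : ∀ v ≥ v₁, ∀ t, M v ≤ t → t < M (v + 1) →
      t ^ ((n : ℝ) / (m : ℝ)) * L v ≤ 2 * c := by
    intro v hv t h1 h2
    have hvt := hv₁ v hv
    rw [← hMdef] at hvt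
    have := ht₀ t (by linarith)
    rwa [hpsi v t h1 h2] at this
  have hLle : ∀ v ≥ v₁, ∀ t, M v ≤ t → t < M (v + 1) → L v ≤ 2 * c := by
    intro v hv t h1 h2
    refine le_trans ?_ (hbound v hv t h1 h2)
    exact le_mul_of_one_le_left (hLnn v)
      (Real.one_le_rpow ((hM1 v).trans h1) (by positivity))
  have hgap := exists_gap hN1' hN2 hκ₂ hle2 V bh bt M L hMdef hLdef hM hL
    (fun v => hpsi v (M v) le_rfl (hM (Nat.lt_succ_self v))) v₁
    (fun v hv => (hLle v hv (M v) le_rfl (hM (Nat.lt_succ_self v))).trans hc2)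
  set W : Set ℕ := {v | v₁ ≤ v ∧ M v ≤ M (v + 1) - 1 / 2} with hW
  have hWinf : W.Infinite := by
    refine Set.infinite_of_forall_exists_gt fun a => ?_
    obtain ⟨v, hv, hv'⟩ := hgap (max v₁ (a + 1))
    exact ⟨v, ⟨(le_max_left _ _).trans hv, hv'⟩, (le_max_right v₁ (a + 1)).trans hv⟩
  let D : Set (Fin m → Fin (n - 2) → ℝ) :=
    Set.univ.pi fun _ => Set.univ.pi fun _ => Set.Icc (0 : ℝ) s
  have hDmem : ∀ B ∈ D, ∀ j i, B j i ∈ Set.Icc (0 : ℝ) s := fun B hB j i =>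
    hB j (Set.mem_univ _) i (Set.mem_univ _)
  have hDvol : volume D = ENNReal.ofReal δ := by
    simp only [D, volume_pi_pi, Real.volume_Icc, sub_zero, Finset.prod_const, Finset.card_univ,
      Fintype.card_fin]
    rw [hδ, ENNReal.ofReal_pow (by positivity), ENNReal.ofReal_pow hs0.le]
  let G : ℕ → Set (Fin m → Fin (n - 2) → ℝ) := fun v =>
    {B | ∀ (b : Fin n → ℤ) (c : Fin m → ℤ), intTail b ≠ 0 →
      N1 (fun i => (b i : ℝ)) ≤ M (v + 1) - 1 / 2 →
      L v ≤ N2 (fun j => (∑ i, glueMat m n V B j i * (b i : ℝ)) + (c j : ℝ))}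
  have hGbad : ∀ v ∈ W, volume (D \ G v) ≤ volume D / 2 := by
    rintro v ⟨hv, hgapv⟩
    have hT1 : 1 ≤ M (v + 1) - 1 / 2 := (hM1 v).trans hgapv
    have hTlt : M (v + 1) - 1 / 2 < M (v + 1) := by linarith
    refine le_trans (measure_mono ?_) ((volume_bad_le hn hκ₁ hκ₂ hle1 hle2 V hT1 (hLnn v)
      ((hLle v hv _ hgapv hTlt).trans hc2)).trans ?_)
    · rintro B ⟨hBD, hBG⟩
      refine ⟨fun j i => Set.Icc_subset_Icc_right hs1 (hDmem B hBD j i), ?_⟩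
      simp only [G, Set.mem_ofPred_eq] at hBG
      push Not at hBG
      obtain ⟨b, c, h1, h2, h3⟩ := hBG
      exact ⟨b, c, h1, h2, h3⟩
    · rw [hDvol, ← ENNReal.ofReal_ofNat, ← ENNReal.ofReal_div_of_pos two_pos]
      apply ENNReal.ofReal_le_ofReal
      refine le_trans ?_ hc3
      set T := M (v + 1) - 1 / 2
      have hpow : T ^ n * L v ^ m ≤ 2 * c := by
        have hT0 : 0 ≤ T := by linarith
        have e : T ^ n = (T ^ ((n : ℝ) / (m : ℝ))) ^ m := by
          rw [← Real.rpow_natCast (T ^ ((n : ℝ) / (m : ℝ))), ← Real.rpow_mul hT0,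
            div_mul_cancel₀ _ (by positivity), Real.rpow_natCast]
        rw [e, ← mul_pow]
        calc (T ^ ((n : ℝ) / (m : ℝ)) * L v) ^ m ≤ (2 * c) ^ m :=
              pow_le_pow_left₀ (mul_nonneg (Real.rpow_nonneg hT0 _) (hLnn v))
                (hbound v hv T hgapv hTlt) m
          _ ≤ 2 * c := pow_le_of_le_one (by positivity) hc1 hm.ne'
      calc ((2 / κ₁ + 1) * T) ^ n * (2 * (2 * ((n - 2 : ℕ) : ℝ) + 3) * (L v / κ₂)) ^ m
          = A * (T ^ n * L v ^ m) := by
            rw [hA, mul_div_assoc', mul_div_right_comm, mul_pow, mul_pow]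
            ring
        _ ≤ A * (2 * c) := by gcongr
  refine ⟨D ∩ {B | {v | v ∈ W ∧ B ∈ G v}.Infinite}, ?_, ?_, ?_⟩
  · rintro B ⟨hBD, -⟩
    have hsq : ∀ j i, (B j i) ^ 2 ≤ s ^ 2 := fun j i =>
      pow_le_pow_left₀ (hDmem B hBD j i).1 (hDmem B hBD j i).2 2
    have hcast : ((n - 2 : ℕ) : ℝ) ≤ n := by exact_mod_cast Nat.sub_le n 2
    calc ∑ j, ∑ i, (B j i) ^ 2 ≤ ∑ _j : Fin m, ∑ _i : Fin (n - 2), s ^ 2 :=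
          Finset.sum_le_sum fun j _ => Finset.sum_le_sum fun i _ => hsq j i
      _ = m * (((n - 2 : ℕ) : ℝ) * s ^ 2) := by simp
      _ ≤ m * (n * s ^ 2) := by gcongr
      _ = s := by
        rw [hs]
        field_simp
      _ ≤ 1 := hs1
  · refine measure_infinitely_often_pos volume ?_ ?_ W hWinf G hGbad
    · rw [hDvol]
      simpa using hδ0
    · rw [hDvol]
      exact ENNReal.ofReal_ne_top
  · rintro B ⟨-, hB⟩
    refine Set.Infinite.mono ?_ hB
    rintro v ⟨⟨-, hgapv⟩, hBG⟩
    have hp := hpsi v _ hgapv (by linarith)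
    refine ⟨psiGen_glueMat_eq hn hN2 V B (bh v) (bt v) ?_ ?_ (hLdef v) hp hBG, hp⟩
    · rw [← hMdef]
      exact hM1 v
    · rw [← hMdef]
      exact hgapv
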